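/- Let T be the standard baker's map, T(x,y) = (x/2, 2y) if y < 1/2 and T(x,y) = ((x+1)/2, 2y−1) if y ≥ 1/2, preserving Lebesgue measure Leb on [0,1]². For Lebesgue-almost every z ∈ [0,1]² (in particular z is not periodic) the following holds: for every t > 0 and every k ∈ ℕ, Leb( { x ∈ [0,1]² : ∑_{i=0}^{⌊ t / Leb(B(z,r)) ⌋} 1_{B(z,r)}(T^i x) = k } ) → e^{−t} t^k / k! as r → 0, where B(z,r) is the open Euclidean ball. -/

import Mathlib

open MeasureTheory Filter
open scoped Classical Topology

/-- The standard baker's map: `T(x,y) = (x/2, 2y)` if `y < 1/2` and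
`T(x,y) = ((x+1)/2, 2y-1)` if `y ≥ 1/2`. -/
noncomputable def bakerMap (p : ℝ × ℝ) : ℝ × ℝ :=
  if p.2 < 1 / 2 then (p.1 / 2, 2 * p.2) else ((p.1 + 1) / 2, 2 * p.2 - 1)

/-- The unit square `[0,1]²`. -/
def unitSq : Set (ℝ × ℝ) := Set.Icc (0:ℝ) 1 ×ˢ Set.Icc (0:ℝ) 1

/-- The open Euclidean ball of center `z` and radius `r` in `ℝ²`. -/
def euclBall (z : ℝ × ℝ) (r : ℝ) : Set (ℝ × ℝ) :=
  {w | Real.sqrt ((w.1 - z.1) ^ 2 + (w.2 - z.2) ^ 2) < r}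


section BakerAux
open Set

variable {Ω : Type*}

noncomputable def cnt (T : Ω → Ω) (A : Set Ω) (n : ℕ) (x : Ω) : ℕ :=
  ∑ i ∈ Finset.range n, A.indicator (fun _ => (1:ℕ)) (T^[i] x)

lemma cnt_succ (T : Ω → Ω) (A : Set Ω) (n : ℕ) (x : Ω) :
    cnt T A (n+1) x = A.indicator (fun _ => (1:ℕ)) x + cnt T A n (T x) := by
  unfold cnt
  rw [Finset.sum_range_succ', add_comm]
  simp [Function.iterate_succ_apply]

lemma cnt_skip (T : Ω → Ω) (A : Set Ω) (h : ℕ) : ∀ (n : ℕ) (x : Ω)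
    (_ : ∀ i < h, T^[i] x ∉ A), cnt T A n x = cnt T A (n - h) (T^[h] x) := by
  induction h with
  | zero => intro n x _; simp
  | succ h ih =>
    intro n x hx
    cases n with
    | zero => simp [cnt]
    | succ n =>
      rw [cnt_succ, ih n (T x) (fun i hi => by
        have := hx (i+1) (by omega); rwa [Function.iterate_succ_apply] at this)]
      have h0 : x ∉ A := hx 0 (by omega)
      simp [h0, Function.iterate_succ_apply]

variable [MeasurableSpace Ω]

lemma measurable_cnt {T : Ω → Ω} (hT : Measurable T) {A : Set Ω} (hA : MeasurableSet A) (n : ℕ) :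
    Measurable (cnt T A n) := by
  unfold cnt
  refine Finset.measurable_sum _ (fun i _ => ?_)
  exact (measurable_const.indicator hA).comp (hT.iterate i)

lemma abs_real_sub_le {μ : Measure Ω} [IsProbabilityMeasure μ] {s t u : Set Ω}
    (h1 : s ⊆ t ∪ u) (h2 : t ⊆ s ∪ u) : |μ.real s - μ.real t| ≤ μ.real u := by
  have a1 := (measureReal_mono (μ := μ) h1).trans (measureReal_union_le t u)
  have a2 := (measureReal_mono (μ := μ) h2).trans (measureReal_union_le s u)
  rw [abs_le]; constructor <;> linarith

lemma real_preimage {μ : Measure Ω} {T : Ω → Ω} (hT : MeasurePreserving T μ μ) {s : Set Ω}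
    (hs : MeasurableSet s) (i : ℕ) : μ.real ((T^[i])⁻¹' s) = μ.real s := by
  simp only [Measure.real, (hT.iterate i).measure_preimage hs.nullMeasurableSet]

lemma cnt_approx {μ : Measure Ω} [IsProbabilityMeasure μ] {T : Ω → Ω}
    (hT : MeasurePreserving T μ μ) {A B D : Set Ω} (hD : MeasurableSet D)
    (hAB : ∀ x, x ∉ D → (x ∈ A ↔ x ∈ B)) (n k : ℕ) :
    |μ.real {x | cnt T B n x = k} - μ.real {x | cnt T A n x = k}| ≤ n * μ.real D := by
  have key : ∀ x, x ∉ (⋃ i ∈ Finset.range n, (T^[i])⁻¹' D) → cnt T A n x = cnt T B n x := by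
    intro x hx
    simp only [mem_iUnion, not_exists] at hx
    unfold cnt
    refine Finset.sum_congr rfl (fun i hi => ?_)
    have := hAB _ (hx i hi)
    simp [Set.indicator, this]
  have h : |μ.real {x | cnt T B n x = k} - μ.real {x | cnt T A n x = k}|
      ≤ μ.real (⋃ i ∈ Finset.range n, (T^[i])⁻¹' D) := by
    apply abs_real_sub_le
    · intro x hx
      by_cases hx' : x ∈ (⋃ i ∈ Finset.range n, (T^[i])⁻¹' D)
      · exact Or.inr hx'
      · left; simpa [key x hx'] using hx
    · intro x hx
      by_cases hx' : x ∈ (⋃ i ∈ Finset.range n, (T^[i])⁻¹' D)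
      · exact Or.inr hx'
      · left; simpa [key x hx'] using hx
  refine h.trans ((measureReal_biUnion_finset_le _ _).trans ?_)
  simp [real_preimage hT hD]

noncomputable def binp (p : ℝ) (n k : ℕ) : ℝ := n.choose k * p ^ k * (1 - p) ^ (n - k)

lemma binp_succ_zero (p : ℝ) (n : ℕ) : binp p (n+1) 0 = (1-p) * binp p n 0 := by
  simp [binp, pow_succ, mul_comm]

lemma binp_succ_succ (p : ℝ) (n k : ℕ) :
    binp p (n+1) (k+1) = (1-p) * binp p n (k+1) + p * binp p n k := by
  unfold binp
  rw [Nat.choose_succ_succ]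
  rcases le_or_gt (k+1) n with h | h
  · obtain ⟨d, rfl⟩ := Nat.exists_eq_add_of_le h
    have e1 : k + 1 + d + 1 - (k+1) = d + 1 := by omega
    have e2 : k + 1 + d - (k+1) = d := by omega
    have e3 : k + 1 + d - k = d + 1 := by omega
    rw [e1, e2, e3]; push_cast; ring
  · rw [Nat.choose_eq_zero_of_lt h]
    have e1 : n + 1 - (k+1) = n - k := by omega
    rw [e1]; push_cast; ring

lemma poisson_abs {μ : Measure Ω} [IsProbabilityMeasure μ] {T : Ω → Ω}
    (hT : MeasurePreserving T μ μ) {A : Set Ω} (hA : MeasurableSet A) (h : ℕ)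
    (hind : ∀ n k, μ.real (A ∩ (T^[h+1])⁻¹' {x | cnt T A n x = k})
      = μ.real A * μ.real {x | cnt T A n x = k})
    (δ : ℝ) (hδ : ∑ j ∈ Finset.range h, μ.real (A ∩ (T^[j+1])⁻¹' A) ≤ δ)
    (p : ℝ) (hp0 : 0 ≤ p) (hp1 : p ≤ 1) (n : ℕ) : ∀ k,
    |μ.real {x | cnt T A n x = k} - binp p n k|
      ≤ n * (2 * (δ + h * μ.real A ^ 2 + |μ.real A - p|)) := by
  set a := μ.real A with ha
  have ha0 : 0 ≤ a := measureReal_nonneg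
  have hms : ∀ n k, MeasurableSet {x | cnt T A n x = k} := fun n k =>
    measurable_cnt hT.measurable hA n (measurableSet_singleton k)
  have hq1 : ∀ n k, μ.real {x | cnt T A n x = k} ≤ 1 := fun n k => measureReal_le_one
  have hq0 : ∀ n k, 0 ≤ μ.real {x | cnt T A n x = k} := fun n k => measureReal_nonneg
  -- main estimate
  have key : ∀ n k, |μ.real (A ∩ T⁻¹' {x | cnt T A n x = k}) - a * μ.real {x | cnt T A n x = k}|
      ≤ δ + h * a ^ 2 := by
    intro n k
    have e1 : |μ.real (A ∩ T⁻¹' {x | cnt T A n x = k})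
        - μ.real (A ∩ (T^[h+1])⁻¹' {x | cnt T A (n-h) x = k})| ≤ δ := by
      refine (abs_real_sub_le (u := ⋃ j ∈ Finset.range h, A ∩ (T^[j+1])⁻¹' A) ?_ ?_).trans
        ((measureReal_biUnion_finset_le _ _).trans hδ)
      · rintro x ⟨hx, hx2⟩
        by_cases hx' : ∀ i < h, T^[i] (T x) ∉ A
        · left; refine ⟨hx, ?_⟩
          have := cnt_skip T A h n (T x) hx'
          simp only [mem_preimage, mem_setOf_eq, Function.iterate_succ_apply] at hx2 ⊢
          rw [← this, hx2]
        · right; push Not at hx'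
          obtain ⟨i, hi, hi2⟩ := hx'
          simp only [mem_iUnion]
          exact ⟨i, Finset.mem_range.2 hi, hx, by simpa [Function.iterate_succ_apply] using hi2⟩
      · rintro x ⟨hx, hx2⟩
        by_cases hx' : ∀ i < h, T^[i] (T x) ∉ A
        · left; refine ⟨hx, ?_⟩
          have := cnt_skip T A h n (T x) hx'
          simp only [mem_preimage, mem_setOf_eq, Function.iterate_succ_apply] at hx2 ⊢
          rw [this, hx2]
        · right; push Not at hx'
          obtain ⟨i, hi, hi2⟩ := hx'
          simp only [mem_iUnion]
          exact ⟨i, Finset.mem_range.2 hi, hx, by simpa [Function.iterate_succ_apply] using hi2⟩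
    have e2 : |μ.real {x | cnt T A (n-h) x = k} - μ.real {x | cnt T A n x = k}| ≤ h * a := by
      rw [← real_preimage hT (hms (n-h) k) h]
      refine (abs_real_sub_le (u := ⋃ j ∈ Finset.range h, (T^[j])⁻¹' A) ?_ ?_).trans
        ((measureReal_biUnion_finset_le _ _).trans (by simp [real_preimage hT hA, ha]))
      · intro x hx2
        by_cases hx' : ∀ i < h, T^[i] x ∉ A
        · left
          have := cnt_skip T A h n x hx'
          simp only [mem_preimage, mem_setOf_eq] at hx2 ⊢
          rw [this, hx2]
        · right; push Not at hx'
          obtain ⟨i, hi, hi2⟩ := hx'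
          simp only [mem_iUnion]
          exact ⟨i, Finset.mem_range.2 hi, hi2⟩
      · intro x hx2
        by_cases hx' : ∀ i < h, T^[i] x ∉ A
        · left
          have := cnt_skip T A h n x hx'
          simp only [mem_preimage, mem_setOf_eq] at hx2 ⊢
          rw [← this, hx2]
        · right; push Not at hx'
          obtain ⟨i, hi, hi2⟩ := hx'
          simp only [mem_iUnion]
          exact ⟨i, Finset.mem_range.2 hi, hi2⟩
    rw [hind] at e1
    rw [abs_le] at *
    constructor <;> nlinarith [e1.1, e1.2, mul_le_mul_of_nonneg_left e2.1 ha0,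
      mul_le_mul_of_nonneg_left e2.2 ha0]
  have hδ0 : 0 ≤ δ + h * a ^ 2 := (abs_nonneg _).trans (key 0 0)
  have key2 : ∀ n k, |μ.real (A ∩ T⁻¹' {x | cnt T A n x = k}) - p * μ.real {x | cnt T A n x = k}|
      ≤ δ + h * a ^ 2 + |a - p| := by
    intro n k
    have e : μ.real (A ∩ T⁻¹' {x | cnt T A n x = k}) - p * μ.real {x | cnt T A n x = k} =
      (μ.real (A ∩ T⁻¹' {x | cnt T A n x = k}) - a * μ.real {x | cnt T A n x = k}) +
      (a - p) * μ.real {x | cnt T A n x = k} := by ring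
    rw [e]
    refine (abs_add_le _ _).trans (add_le_add (key n k) ?_)
    rw [abs_mul, abs_of_nonneg (hq0 n k)]
    exact mul_le_of_le_one_right (abs_nonneg _) (hq1 n k)
  have comp : ∀ n k, μ.real (Aᶜ ∩ T⁻¹' {x | cnt T A n x = k}) =
      μ.real {x | cnt T A n x = k} - μ.real (A ∩ T⁻¹' {x | cnt T A n x = k}) := by
    intro n k
    have := measureReal_inter_add_diff (μ := μ) (s := T⁻¹' {x | cnt T A n x = k}) hA
    have h2 := real_preimage hT (hms n k) 1
    simp only [Function.iterate_one] at h2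
    rw [h2, diff_eq, inter_comm, inter_comm (T⁻¹' _) Aᶜ] at this
    linarith
  set ε := δ + h * a ^ 2 + |a - p| with hε
  have hε0 : 0 ≤ ε := by positivity
  induction n with
  | zero =>
    intro k
    cases k <;> simp [cnt, binp]
  | succ n ih =>
    intro k
    cases k with
    | zero =>
      have e : {x | cnt T A (n+1) x = 0} = Aᶜ ∩ T⁻¹' {x | cnt T A n x = 0} := by
        ext x
        by_cases hx : x ∈ A <;> simp [cnt_succ, hx]
      rw [e, comp, binp_succ_zero]
      have h1 := key2 n 0
      have h2 := ih 0
      have h3 := abs_le.1 h2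
      rw [abs_le] at h1 ⊢
      push_cast
      constructor <;> nlinarith
    | succ k =>
      have e : {x | cnt T A (n+1) x = k+1} = (Aᶜ ∩ T⁻¹' {x | cnt T A n x = k+1}) ∪
          (A ∩ T⁻¹' {x | cnt T A n x = k}) := by
        ext x
        by_cases hx : x ∈ A <;> simp [cnt_succ, hx, add_comm 1]
      rw [e, measureReal_union (by
        refine Disjoint.mono inter_subset_left inter_subset_left disjoint_compl_left)
        (hA.inter (hT.measurable (hms n k))), comp, binp_succ_succ]
      have h1 := abs_le.1 (key2 n (k+1))
      have h1' := abs_le.1 (key2 n k)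
      have h2 := abs_le.1 (ih (k+1))
      have h3 := abs_le.1 (ih k)
      have hp' : 0 ≤ 1 - p := by linarith
      rw [abs_le]
      push_cast
      have m1 := mul_le_mul_of_nonneg_left h2.1 hp'
      have m2 := mul_le_mul_of_nonneg_left h2.2 hp'
      have m3 := mul_le_mul_of_nonneg_left h3.1 hp0
      have m4 := mul_le_mul_of_nonneg_left h3.2 hp0
      constructor <;> nlinarith

noncomputable def lam : Measure ℝ := volume.restrict (Ico (0:ℝ) 1)

instance : IsProbabilityMeasure lam := ⟨by simp [lam]⟩

lemma restrict_unitSq : (volume : Measure (ℝ × ℝ)).restrict unitSq = lam.prod lam := by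
  unfold lam unitSq
  rw [Measure.prod_restrict, ← Measure.volume_eq_prod]
  apply Measure.restrict_congr_set
  exact Measure.set_prod_ae_eq Ico_ae_eq_Icc.symm Ico_ae_eq_Icc.symm

lemma ae_lam : ∀ᵐ x ∂lam, x ∈ Ico (0:ℝ) 1 := ae_restrict_mem measurableSet_Ico

lemma lam_congr {s t : Set ℝ} (h : ∀ u ∈ Ico (0:ℝ) 1, (u ∈ s ↔ u ∈ t)) : lam s = lam t := by
  apply measure_congr
  filter_upwards [ae_lam] with u hu
  exact propext (h u hu)

lemma ae_lam2 : ∀ᵐ x ∂(lam.prod lam), x.1 ∈ Ico (0:ℝ) 1 ∧ x.2 ∈ Ico (0:ℝ) 1 := by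
  have : lam.prod lam = (volume : Measure (ℝ × ℝ)).restrict (Ico (0:ℝ) 1 ×ˢ Ico (0:ℝ) 1) := by
    unfold lam
    rw [Measure.prod_restrict, ← Measure.volume_eq_prod]
  rw [this]
  filter_upwards [ae_restrict_mem (measurableSet_Ico.prod measurableSet_Ico)] with x hx
  exact hx

lemma lam2_congr {s t : Set (ℝ × ℝ)}
    (h : ∀ x ∈ Ico (0:ℝ) 1, ∀ y ∈ Ico (0:ℝ) 1, ((x, y) ∈ s ↔ (x, y) ∈ t)) :
    (lam.prod lam) s = (lam.prod lam) t := by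
  apply measure_congr
  filter_upwards [ae_lam2] with u hu
  exact propext (h u.1 hu.1 u.2 hu.2)

lemma lam_split (M : ℕ) (hM : 0 < M) {S : Set ℝ} (hS : MeasurableSet S) :
    lam S = ENNReal.ofReal (1 / M) * ∑ j ∈ Finset.range M, lam {u | (u + j) / M ∈ S} := by
  have hM' : (0:ℝ) < M := by exact_mod_cast hM
  have hfl : Measurable (fun y : ℝ => ⌊(M:ℝ) * y⌋₊) :=
    Nat.measurable_floor.comp (measurable_const.mul measurable_id)
  have h1 := sum_measure_preimage_singleton (μ := volume.restrict (S ∩ Ico (0:ℝ) 1))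
    (Finset.range M) (f := fun y : ℝ => ⌊(M:ℝ) * y⌋₊)
    (fun j _ => hfl (measurableSet_singleton j))
  have h2 : volume.restrict (S ∩ Ico (0:ℝ) 1)
      ((fun y : ℝ => ⌊(M:ℝ) * y⌋₊) ⁻¹' ↑(Finset.range M)) = lam S := by
    rw [Measure.restrict_apply (hfl (Finset.measurableSet _)), lam, Measure.restrict_apply hS]
    congr 1
    refine inter_eq_right.2 ?_
    rintro y ⟨_, hy0, hy1⟩
    simp only [Finset.coe_range, mem_preimage, mem_Iio]
    rw [Nat.floor_lt (by positivity)]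
    nlinarith
  rw [← h2, ← h1, Finset.mul_sum]
  refine Finset.sum_congr rfl (fun j hj => ?_)
  rw [Measure.restrict_apply (hfl (measurableSet_singleton j))]
  have hm : MeasurableSet {u : ℝ | (u + j) / M ∈ S} :=
    ((measurable_id.add_const _).div_const _) hS
  rw [lam, Measure.restrict_apply hm]
  have e : ((fun y : ℝ => ⌊(M:ℝ) * y⌋₊) ⁻¹' {j} ∩ (S ∩ Ico (0:ℝ) 1)) =
      (fun y => (M:ℝ) * y) ⁻¹' ((fun y => y - (j:ℝ)) ⁻¹' ({u : ℝ | (u + j) / M ∈ S} ∩ Ico (0:ℝ) 1)) := by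
    have hj' : (j:ℝ) + 1 ≤ M := by exact_mod_cast Finset.mem_range.1 hj
    ext y
    have e2 : ((M:ℝ) * y - j + j) / M = y := by field_simp; ring
    have hj0 : (0:ℝ) ≤ j := Nat.cast_nonneg j
    simp only [mem_inter_iff, mem_preimage, mem_singleton_iff, mem_setOf_eq, e2, mem_Ico]
    constructor
    · rintro ⟨hf, hs, h0, h1⟩
      rw [Nat.floor_eq_iff (by positivity)] at hf
      exact ⟨hs, by linarith, by linarith⟩
    · rintro ⟨hs, h0, h1⟩
      have y0 : 0 ≤ y := by
        by_contra hc; push Not at hc; nlinarith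
      refine ⟨(Nat.floor_eq_iff (by positivity)).2 ⟨by linarith, by linarith⟩, hs, y0, ?_⟩
      by_contra hc; push Not at hc; nlinarith
  simp only [sub_eq_add_neg] at e
  rw [e, Real.volume_preimage_mul_left hM'.ne', measure_preimage_add_right,
    abs_of_pos (by positivity), one_div]

lemma measurable_baker : Measurable bakerMap := by
  unfold bakerMap
  refine Measurable.ite (measurableSet_lt measurable_snd measurable_const) ?_ ?_ <;> fun_prop

lemma baker_mp : MeasurePreserving bakerMap (lam.prod lam) (lam.prod lam) := by
  refine ⟨measurable_baker, ?_⟩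
  ext S hS
  rw [Measure.map_apply measurable_baker hS, Measure.prod_apply (measurable_baker hS)]
  have m0 : Measurable (fun p : ℝ × ℝ => (p.1 / 2, p.2)) := by fun_prop
  have m1 : Measurable (fun p : ℝ × ℝ => ((p.1 + 1) / 2, p.2)) := by fun_prop
  have h1 : ∀ x, lam (Prod.mk x ⁻¹' (bakerMap ⁻¹' S)) = ENNReal.ofReal (1/(2:ℕ)) *
      (lam (Prod.mk x ⁻¹' ((fun p : ℝ × ℝ => (p.1 / 2, p.2)) ⁻¹' S)) +
        lam (Prod.mk x ⁻¹' ((fun p : ℝ × ℝ => ((p.1 + 1) / 2, p.2)) ⁻¹' S))) := by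
    intro x
    rw [lam_split 2 (by norm_num) (measurable_prodMk_left (measurable_baker hS)),
      Finset.sum_range_succ, Finset.sum_range_one]
    congr 2
    · apply lam_congr
      rintro u ⟨hu0, hu1⟩
      have : u / 2 < 1 / 2 := by linarith
      have h3 : 2 * (u / 2) = u := by ring
      simp only [mem_preimage, mem_setOf_eq, bakerMap]
      norm_num [h3]
      rw [if_pos (by linarith)]
    · apply lam_congr
      rintro u ⟨hu0, hu1⟩
      have : ¬ (u + 1) / 2 < 1 / 2 := by linarith
      have h3 : 2 * ((u + 1) / 2) - 1 = u := by ring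
      simp only [mem_preimage, mem_setOf_eq, bakerMap]
      norm_num [h3]
      rw [if_neg (by linarith)]
  simp_rw [h1]
  rw [lintegral_const_mul' _ _ ENNReal.ofReal_ne_top,
    lintegral_add_left (measurable_measure_prodMk_left (m0 hS)),
    ← Measure.prod_apply (m0 hS), ← Measure.prod_apply (m1 hS),
    Measure.prod_apply_symm (m0 hS), Measure.prod_apply_symm (m1 hS), Measure.prod_apply_symm hS,
    ← lintegral_add_left (measurable_measure_prodMk_right (m0 hS)),
    ← lintegral_const_mul' _ _ ENNReal.ofReal_ne_top]
  refine lintegral_congr (fun u => ?_)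
  rw [lam_split 2 (by norm_num) (measurable_prodMk_right hS), Finset.sum_range_succ, Finset.sum_range_one]
  congr 3
  · ext x; simp
  · ext x; simp

lemma baker_iter (y : ℝ) (hy : y ∈ Ico (0:ℝ) 1) (n : ℕ) :
    ∃ c : ℕ, (c:ℝ) + 1 ≤ 2 ^ n ∧ ∀ x, bakerMap^[n] (x, y) = ((x + c) / 2 ^ n, Int.fract (2 ^ n * y)) := by
  induction n with
  | zero => exact ⟨0, by simp, fun x => by simp [Int.fract_eq_self.2 hy]⟩
  | succ n ih =>
    obtain ⟨c, hc1, hc⟩ := ih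
    have f0 := Int.fract_nonneg ((2:ℝ) ^ n * y)
    have f1 := Int.fract_lt_one ((2:ℝ) ^ n * y)
    have f2 := Int.self_sub_floor ((2:ℝ) ^ n * y)
    by_cases h : Int.fract ((2:ℝ) ^ n * y) < 1 / 2
    · refine ⟨c, by rw [pow_succ]; linarith [Nat.cast_nonneg (α := ℝ) c], fun x => ?_⟩
      rw [Function.iterate_succ_apply', hc, bakerMap, if_pos h]
      ext
      · simp only; rw [pow_succ]; field_simp
      · simp only; symm
        rw [Int.fract_eq_iff]
        refine ⟨by linarith, by linarith, 2 * ⌊(2:ℝ) ^ n * y⌋, ?_⟩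
        push_cast; rw [← f2]; ring
    · refine ⟨c + 2 ^ n, by push_cast; rw [pow_succ]; linarith, fun x => ?_⟩
      rw [Function.iterate_succ_apply', hc, bakerMap, if_neg h]
      ext
      · simp only; push_cast; rw [pow_succ]; field_simp; try ring
      · simp only; symm
        rw [Int.fract_eq_iff]
        refine ⟨by linarith, by linarith, 2 * ⌊(2:ℝ) ^ n * y⌋ + 1, ?_⟩
        push_cast; rw [← f2]; ring

/-- rounding to the dyadic grid -/
noncomputable def rnd (m : ℕ) (w : ℝ × ℝ) : ℝ × ℝ :=
  ((⌊(2:ℝ) ^ m * w.1⌋ : ℝ) / 2 ^ m, (⌊(2:ℝ) ^ m * w.2⌋ : ℝ) / 2 ^ m)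

lemma measurable_rnd (m : ℕ) : Measurable (rnd m) := by
  unfold rnd
  refine Measurable.prodMk ?_ ?_
  · refine Measurable.div_const ((measurable_from_top (f := fun n : ℤ => (n : ℝ))).comp (Int.measurable_floor.comp ?_)) _
    fun_prop
  · refine Measurable.div_const ((measurable_from_top (f := fun n : ℤ => (n : ℝ))).comp (Int.measurable_floor.comp ?_)) _
    fun_prop

lemma rnd_iter (m i : ℕ) (x : ℝ) (hx : x ∈ Ico (0:ℝ) 1) (y : ℝ) (hy : y ∈ Ico (0:ℝ) 1) :
    rnd m (bakerMap^[i + m] (x, y)) = rnd m (bakerMap^[i + m] (0, y)) := by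
  obtain ⟨c, _, hc⟩ := baker_iter y hy (i + m)
  rw [hc, hc]
  unfold rnd
  have key : ∀ v ∈ Ico (0:ℝ) 1, ⌊(2:ℝ) ^ m * ((v + c) / 2 ^ (i + m))⌋ = (c : ℤ) / ((2 ^ i : ℕ) : ℤ) := by
    intro v hv
    have : (2:ℝ) ^ m * ((v + c) / 2 ^ (i + m)) = (v + c) / ((2 ^ i : ℕ) : ℝ) := by
      push_cast; rw [pow_add]; field_simp
    rw [this, Int.floor_div_natCast]
    congr 1
    rw [Int.floor_eq_iff]
    push_cast
    constructor <;> linarith [hv.1, hv.2]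
  simp only
  rw [key x hx, key 0 (by simp)]

lemma cnt_iter (m : ℕ) (B : Set (ℝ × ℝ)) (n : ℕ) (x : ℝ) (hx : x ∈ Ico (0:ℝ) 1) (y : ℝ)
    (hy : y ∈ Ico (0:ℝ) 1) :
    cnt bakerMap (rnd m ⁻¹' B) n (bakerMap^[m] (x, y)) =
      cnt bakerMap (rnd m ⁻¹' B) n (bakerMap^[m] (0, y)) := by
  unfold cnt
  refine Finset.sum_congr rfl (fun i _ => ?_)
  simp only [← Function.iterate_add_apply, indicator, mem_preimage, rnd_iter m i x hx y hy]

lemma lam_indep (m : ℕ) (D : Set ℤ) {G : Set ℝ} (hG : MeasurableSet G) :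
    lam {y | ⌊(2:ℝ) ^ m * y⌋ ∈ D ∧ Int.fract ((2:ℝ) ^ m * y) ∈ G} =
      lam {y | ⌊(2:ℝ) ^ m * y⌋ ∈ D} * lam G := by
  have main : ∀ H : Set ℝ, MeasurableSet H →
      lam {y | ⌊(2:ℝ) ^ m * y⌋ ∈ D ∧ Int.fract ((2:ℝ) ^ m * y) ∈ H} =
      ENNReal.ofReal (1 / (2 ^ m : ℕ)) *
        (∑ j ∈ Finset.range (2 ^ m), if (j : ℤ) ∈ D then 1 else 0) * lam H := by
    intro H hH
    have ms : MeasurableSet {y | ⌊(2:ℝ) ^ m * y⌋ ∈ D ∧ Int.fract ((2:ℝ) ^ m * y) ∈ H} := by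
      refine MeasurableSet.inter ?_ ?_
      · exact (Int.measurable_floor.comp (measurable_const.mul measurable_id))
          (MeasurableSet.of_discrete (s := D))
      · exact (measurable_fract.comp (measurable_const.mul measurable_id)) hH
    rw [lam_split (2 ^ m) (by positivity) ms, mul_assoc, Finset.sum_mul]
    congr 1
    refine Finset.sum_congr rfl (fun j _ => ?_)
    have e : ∀ u ∈ Ico (0:ℝ) 1, (u ∈ {u : ℝ | (u + j) / (2 ^ m : ℕ) ∈
        {y | ⌊(2:ℝ) ^ m * y⌋ ∈ D ∧ Int.fract ((2:ℝ) ^ m * y) ∈ H}} ↔ (j : ℤ) ∈ D ∧ u ∈ H) := by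
      intro u hu
      have e1 : (2:ℝ) ^ m * ((u + j) / (2 ^ m : ℕ)) = u + j := by push_cast; field_simp
      have e2 : ⌊u + j⌋ = (j : ℤ) := by
        rw [Int.floor_eq_iff]
        push_cast
        constructor <;> linarith [hu.1, hu.2]
      simp only [mem_setOf_eq, e1, e2, Int.fract_add_natCast, Int.fract_eq_self.2 hu]
    by_cases hj : (j : ℤ) ∈ D
    · rw [lam_congr (t := H) (fun u hu => by rw [e u hu]; simp [hj])]
      simp [hj]
    · rw [lam_congr (t := ∅) (fun u hu => by rw [e u hu]; simp [hj])]
      simp [hj]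
  have h1 := main univ MeasurableSet.univ
  simp only [mem_univ, and_true, measure_univ, mul_one] at h1
  rw [main G hG, h1]

lemma indep_baker (m : ℕ) {B : Set (ℝ × ℝ)} (hB : MeasurableSet B) (n k : ℕ) :
    (lam.prod lam) ((rnd m ⁻¹' B) ∩
      (bakerMap^[m + m])⁻¹' {x | cnt bakerMap (rnd m ⁻¹' B) n x = k}) =
    (lam.prod lam) (rnd m ⁻¹' B) *
      (lam.prod lam) {x | cnt bakerMap (rnd m ⁻¹' B) n x = k} := by
  have hA : MeasurableSet (rnd m ⁻¹' B) := measurable_rnd m hB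
  set A := rnd m ⁻¹' B with hAdef
  have hF : MeasurableSet {x | cnt bakerMap A n x = k} :=
    measurable_cnt measurable_baker hA n (measurableSet_singleton k)
  set G : Set ℝ := {y | cnt bakerMap A n (bakerMap^[m] (0, y)) = k} with hGdef
  have hG : MeasurableSet G := by
    have : Measurable (fun y : ℝ => bakerMap^[m] (0, y)) :=
      (measurable_baker.iterate m).comp (by fun_prop)
    exact this hF
  have e1 : (lam.prod lam) {x | cnt bakerMap A n x = k} = lam G := by
    rw [← (baker_mp.iterate m).measure_preimage hF.nullMeasurableSet,
      lam2_congr (t := univ ×ˢ G)]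
    · rw [Measure.prod_prod]; simp
    · intro x hx y hy
      simp only [mem_preimage, mem_setOf_eq, mem_prod, mem_univ, true_and, hGdef]
      rw [hAdef, cnt_iter m B n x hx y hy]
  have hS : MeasurableSet (A ∩ {p : ℝ × ℝ | Int.fract ((2:ℝ) ^ m * p.2) ∈ G}) := by
    refine hA.inter ?_
    exact (measurable_fract.comp (measurable_const.mul measurable_snd)) hG
  rw [e1, lam2_congr (t := A ∩ {p : ℝ × ℝ | Int.fract ((2:ℝ) ^ m * p.2) ∈ G})]
  · rw [Measure.prod_apply hS, Measure.prod_apply hA, ← lintegral_mul_const']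
    · refine lintegral_congr (fun x => ?_)
      exact lam_indep m {j : ℤ | ((⌊(2:ℝ) ^ m * x⌋ : ℝ) / 2 ^ m, (j : ℝ) / 2 ^ m) ∈ B} hG
    · exact measure_ne_top _ _
  · intro x hx y hy
    simp only [mem_inter_iff, mem_preimage, mem_setOf_eq, hGdef]
    refine and_congr_right (fun _ => ?_)
    obtain ⟨c, hc1, hc⟩ := baker_iter y hy m
    rw [Function.iterate_add_apply, hc, hAdef, cnt_iter m B n]
    · constructor
      · have := hx.1; positivity
      · rw [div_lt_one (by positivity)]; linarith [hx.2]
    · exact ⟨Int.fract_nonneg _, Int.fract_lt_one _⟩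

def toC (w : ℝ × ℝ) : ℂ := ⟨w.1, w.2⟩

lemma mem_euclBall (z w : ℝ × ℝ) (r : ℝ) : w ∈ euclBall z r ↔ dist (toC w) (toC z) < r := by
  rw [Complex.dist_eq_re_im]; rfl

lemma euclBall_eq (z : ℝ × ℝ) (r : ℝ) : euclBall z r =
    Complex.measurableEquivRealProd.symm ⁻¹' Metric.ball (toC z) r := by
  ext w
  rw [mem_euclBall]; rfl

lemma volume_euclBall (z : ℝ × ℝ) (r : ℝ) (hr : 0 ≤ r) :
    volume (euclBall z r) = ENNReal.ofReal (Real.pi * r ^ 2) := by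
  rw [euclBall_eq, Complex.volume_preserving_equiv_real_prod.symm.measure_preimage
    measurableSet_ball.nullMeasurableSet, Complex.volume_ball, mul_comm (Real.pi),
    ENNReal.ofReal_mul (by positivity), ENNReal.ofReal_pow hr]
  congr 1
  rw [← NNReal.coe_real_pi, ENNReal.ofReal_coe_nnreal]

lemma measurableSet_euclBall (z : ℝ × ℝ) (r : ℝ) : MeasurableSet (euclBall z r) := by
  rw [euclBall_eq]
  exact Complex.measurableEquivRealProd.symm.measurable measurableSet_ball

lemma dist_rnd (m : ℕ) (w : ℝ × ℝ) : dist (toC w) (toC (rnd m w)) ≤ 2 / 2 ^ m := by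
  have h2 : (0:ℝ) < 2 ^ m := by positivity
  have key : ∀ v : ℝ, |v - (⌊(2:ℝ) ^ m * v⌋ : ℝ) / 2 ^ m| ≤ 1 / 2 ^ m := by
    intro v
    have e : v - (⌊(2:ℝ) ^ m * v⌋ : ℝ) / 2 ^ m = Int.fract ((2:ℝ) ^ m * v) / 2 ^ m := by
      rw [← Int.self_sub_floor]; field_simp
    rw [e, abs_of_nonneg (by have := Int.fract_nonneg ((2:ℝ) ^ m * v); positivity)]
    exact div_le_div_of_nonneg_right (Int.fract_lt_one _).le h2.le
  rw [Complex.dist_eq]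
  refine (Complex.norm_le_abs_re_add_abs_im _).trans ?_
  have k1 := key w.1
  have k2 := key w.2
  have : (2:ℝ) / 2 ^ m = 1 / 2 ^ m + 1 / 2 ^ m := by ring
  rw [this]
  exact add_le_add k1 k2

lemma rnd_mem (m : ℕ) (z w : ℝ × ℝ) (r : ℝ)
    (hw : w ∉ euclBall z (r + 2 / 2 ^ m) \ euclBall z (r - 2 / 2 ^ m)) :
    w ∈ rnd m ⁻¹' euclBall z r ↔ w ∈ euclBall z r := by
  have h := dist_rnd m w
  have t1 := dist_triangle (toC w) (toC (rnd m w)) (toC z)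
  have t2 := dist_triangle_left (toC (rnd m w)) (toC z) (toC w)
  have h0 : 0 ≤ dist (toC w) (toC (rnd m w)) := dist_nonneg
  simp only [mem_diff, mem_preimage, mem_euclBall, not_and, not_not] at hw ⊢
  constructor
  · intro h1
    have := hw (by linarith)
    linarith
  · intro h1
    have := hw (by linarith)
    linarith

lemma euclBall_subset_ball (z : ℝ × ℝ) (r : ℝ) : euclBall z r ⊆ Metric.ball z r := by
  intro w hw
  rw [mem_euclBall, Complex.dist_eq] at hw
  rw [Metric.mem_ball, Prod.dist_eq, max_lt_iff]
  exact ⟨lt_of_le_of_lt (Complex.abs_re_le_norm (toC w - toC z)) hw,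
    lt_of_le_of_lt (Complex.abs_im_le_norm (toC w - toC z)) hw⟩

lemma card_le_of_interval (M : ℕ) (α β : ℝ) (h : α ≤ β) :
    (((Finset.range M).filter (fun j : ℕ => α < j ∧ (j:ℝ) < β)).card : ℝ) ≤ β - α + 1 := by
  have h1 : ((Finset.range M).filter (fun j : ℕ => α < j ∧ (j:ℝ) < β)).card ≤
      (Finset.Icc ⌈α⌉ ⌊β⌋).card := by
    refine Finset.card_le_card_of_injOn (fun j : ℕ => (j : ℤ)) ?_ ?_
    · intro j hj
      simp only [Finset.coe_filter, mem_setOf_eq, Finset.mem_range, Finset.coe_Icc, mem_Icc] at hj ⊢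
      exact ⟨Int.ceil_le.2 (by exact_mod_cast hj.2.1.le), Int.le_floor.2 (by exact_mod_cast hj.2.2.le)⟩
    · intro a _ b _ hab
      exact Int.ofNat.inj hab
  have h2 : ((Finset.Icc ⌈α⌉ ⌊β⌋).card : ℝ) ≤ β - α + 1 := by
    rw [Int.card_Icc]
    have e : (((⌊β⌋ + 1 - ⌈α⌉).toNat : ℤ) : ℝ) ≤ β - α + 1 := by
      rw [Int.toNat_eq_max]
      push_cast
      apply max_le
      · linarith [Int.floor_le β, Int.le_ceil α]
      · linarith
    exact_mod_cast e
  exact le_trans (by exact_mod_cast h1) h2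

lemma lam_ball_le (b ρ : ℝ) : lam (Metric.ball b ρ) ≤ ENNReal.ofReal (2 * ρ) := by
  rw [← Real.volume_ball b ρ]
  exact Measure.restrict_le_self _

lemma lam_return (b ρ : ℝ) (hρ : 0 < ρ) (j : ℕ) :
    lam {y | y ∈ Metric.ball b ρ ∧ Int.fract ((2:ℝ) ^ j * y) ∈ Metric.ball b ρ} ≤
      ENNReal.ofReal (2 * ρ * (2 * ρ + 2 / 2 ^ j)) := by
  have hP : (0:ℝ) < 2 ^ j := by positivity
  have ms : MeasurableSet {y | y ∈ Metric.ball b ρ ∧ Int.fract ((2:ℝ) ^ j * y) ∈ Metric.ball b ρ} := by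
    refine measurableSet_ball.inter ?_
    exact (measurable_fract.comp (measurable_const.mul measurable_id)) measurableSet_ball
  rw [lam_split (2 ^ j) (by positivity) ms]
  set α : ℝ := 2 ^ j * (b - ρ) - 1 with hα
  set β : ℝ := 2 ^ j * (b + ρ) with hβ
  have hb : ∀ i ∈ Finset.range (2 ^ j), lam {u : ℝ | (u + i) / (2 ^ j : ℕ) ∈
      {y | y ∈ Metric.ball b ρ ∧ Int.fract ((2:ℝ) ^ j * y) ∈ Metric.ball b ρ}} ≤
      if α < i ∧ (i:ℝ) < β then ENNReal.ofReal (2 * ρ) else 0 := by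
    intro i _
    have e : ∀ u ∈ Ico (0:ℝ) 1, (u ∈ {u : ℝ | (u + i) / (2 ^ j : ℕ) ∈
        {y | y ∈ Metric.ball b ρ ∧ Int.fract ((2:ℝ) ^ j * y) ∈ Metric.ball b ρ}} ↔
        u ∈ {u : ℝ | (u + i) / 2 ^ j ∈ Metric.ball b ρ ∧ u ∈ Metric.ball b ρ}) := by
      intro u hu
      have e1 : (2:ℝ) ^ j * ((u + i) / (2 ^ j : ℕ)) = u + i := by push_cast; field_simp
      simp only [mem_setOf_eq, e1, Int.fract_add_natCast, Int.fract_eq_self.2 hu]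
      push_cast; rfl
    split_ifs with hi
    · rw [lam_congr e]
      exact (measure_mono (fun u hu => hu.2)).trans (lam_ball_le b ρ)
    · rw [lam_congr (t := ∅), measure_empty]
      intro u hu
      rw [e u hu]
      simp only [mem_setOf_eq, mem_empty_iff_false, iff_false, not_and]
      intro h1
      exfalso; apply hi
      rw [Metric.mem_ball, Real.dist_eq, abs_lt] at h1
      have h2 : b - ρ < (u + i) / 2 ^ j := by linarith
      have h3 : (u + i) / 2 ^ j < b + ρ := by linarith
      rw [lt_div_iff₀ hP] at h2
      rw [div_lt_iff₀ hP] at h3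
      constructor
      · rw [hα]; linarith [hu.2]
      · rw [hβ]; linarith [hu.1]
  refine (mul_le_mul_right (Finset.sum_le_sum hb) _).trans ?_
  rw [← Finset.sum_filter, Finset.sum_const, nsmul_eq_mul]
  have hc := card_le_of_interval (2 ^ j) α β (by rw [hα, hβ]; nlinarith)
  set K := ((Finset.range (2 ^ j)).filter (fun i : ℕ => α < i ∧ (i:ℝ) < β)).card
  rw [← ENNReal.ofReal_natCast K, ← ENNReal.ofReal_mul (by positivity),
    ← ENNReal.ofReal_mul (by positivity)]
  apply ENNReal.ofReal_le_ofReal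
  have e3 : β - α + 1 = 2 ^ j * (2 * ρ + 2 / 2 ^ j) := by
    rw [hα, hβ]; field_simp; ring
  rw [e3] at hc
  push_cast
  calc 1 / 2 ^ j * (K * (2 * ρ)) ≤ 1 / 2 ^ j * ((2 ^ j * (2 * ρ + 2 / 2 ^ j)) * (2 * ρ)) := by gcongr
    _ = _ := by field_simp

lemma baker_return (z : ℝ × ℝ) (ρ : ℝ) (hρ : 0 < ρ) (j : ℕ) :
    (lam.prod lam).real (Metric.ball z ρ ∩ (bakerMap^[j])⁻¹' Metric.ball z ρ) ≤
      4 * ρ ^ 2 * (2 * ρ + 2 / 2 ^ j) := by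
  rw [Measure.real]
  refine ENNReal.toReal_le_of_le_ofReal (by positivity) ?_
  have h1 : (lam.prod lam) (Metric.ball z ρ ∩ (bakerMap^[j])⁻¹' Metric.ball z ρ) ≤
      (lam.prod lam) (Metric.ball z.1 ρ ×ˢ
        {y | y ∈ Metric.ball z.2 ρ ∧ Int.fract ((2:ℝ) ^ j * y) ∈ Metric.ball z.2 ρ}) := by
    apply measure_mono_ae
    filter_upwards [ae_lam2] with w hw hw2
    obtain ⟨c, _, hc⟩ := baker_iter w.2 hw.2 j
    obtain ⟨a1, a2⟩ := hw2
    rw [mem_preimage, ← Prod.mk.eta (p := w), hc] at a2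
    rw [Metric.mem_ball, Prod.dist_eq, max_lt_iff] at a1 a2
    exact ⟨a1.1, a1.2, a2.2⟩
  refine h1.trans ?_
  rw [Measure.prod_prod]
  refine (mul_le_mul' (lam_ball_le _ _) (lam_return _ _ hρ j)).trans ?_
  rw [← ENNReal.ofReal_mul (by positivity)]
  apply ENNReal.ofReal_le_ofReal
  apply le_of_eq; ring

lemma not_periodic (z : ℝ × ℝ) (h1 : Irrational z.1) (hz : z.2 ∈ Ico (0:ℝ) 1) (n : ℕ) (hn : 1 ≤ n) :
    bakerMap^[n] z ≠ z := by
  intro h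
  obtain ⟨c, _, hc⟩ := baker_iter z.2 hz n
  have := hc z.1
  rw [Prod.mk.eta, h] at this
  have e := congrArg Prod.fst this
  simp only at e
  have hP : (2:ℝ) ≤ 2 ^ n := by
    calc (2:ℝ) = 2 ^ 1 := by norm_num
      _ ≤ 2 ^ n := pow_le_pow_right₀ (by norm_num) hn
  apply h1
  refine ⟨(c:ℚ) / (2 ^ n - 1), ?_⟩
  push_cast
  rw [eq_div_iff (by positivity)] at e
  rw [div_eq_iff (by linarith)]
  linarith

lemma baker_continuousAt (z : ℝ × ℝ) (h2 : Irrational z.2) (hz : z.2 ∈ Ico (0:ℝ) 1) (n : ℕ) :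
    ContinuousAt (bakerMap^[n]) z := by
  induction n with
  | zero => exact continuousAt_id
  | succ n ih =>
    rw [Function.iterate_succ']
    refine ContinuousAt.comp ?_ ih
    obtain ⟨c, _, hc⟩ := baker_iter z.2 hz n
    have e := hc z.1
    rw [Prod.mk.eta] at e
    have hne : (bakerMap^[n] z).2 ≠ 1 / 2 := by
      rw [e]
      simp only
      intro h
      apply h2
      rw [← Int.self_sub_floor] at h
      refine ⟨((⌊(2:ℝ) ^ n * z.2⌋ : ℚ) + 1 / 2) / 2 ^ n, ?_⟩
      push_cast
      rw [div_eq_iff (by positivity)]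
      linarith
    set w := bakerMap^[n] z
    rcases lt_or_gt_of_ne hne with h | h
    · have : (fun p : ℝ × ℝ => (p.1 / 2, 2 * p.2)) =ᶠ[𝓝 w] bakerMap := by
        filter_upwards [(isOpen_lt continuous_snd continuous_const).mem_nhds h] with p hp
        simp only [bakerMap]; rw [if_pos hp]
      exact ContinuousAt.congr (by fun_prop) this
    · have : (fun p : ℝ × ℝ => ((p.1 + 1) / 2, 2 * p.2 - 1)) =ᶠ[𝓝 w] bakerMap := by
        filter_upwards [(isOpen_lt continuous_const continuous_snd).mem_nhds h] with p hp
        simp only [bakerMap]; rw [if_neg (not_lt.2 (le_of_lt hp))]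
      exact ContinuousAt.congr (by fun_prop) this

lemma no_return (z : ℝ × ℝ) (h1 : Irrational z.1) (h2 : Irrational z.2) (hz : z.2 ∈ Ico (0:ℝ) 1)
    (n : ℕ) (hn : 1 ≤ n) :
    ∃ ρ₀ > 0, ∀ ρ ≤ ρ₀, Metric.ball z ρ ∩ (bakerMap^[n])⁻¹' Metric.ball z ρ = ∅ := by
  have hd : 0 < dist (bakerMap^[n] z) z := dist_pos.2 (not_periodic z h1 hz n hn)
  obtain ⟨η, hη, h⟩ := Metric.continuousAt_iff.1 (baker_continuousAt z h2 hz n) _ (half_pos hd)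
  refine ⟨min η (dist (bakerMap^[n] z) z / 2), lt_min hη (half_pos hd), fun ρ hρ => ?_⟩
  rw [eq_empty_iff_forall_notMem]
  rintro w ⟨a, b⟩
  have h3 := h (lt_of_lt_of_le a (hρ.trans (min_le_left _ _)))
  have h4 : dist (bakerMap^[n] w) z < _ := lt_of_lt_of_le b (hρ.trans (min_le_right _ _))
  have := dist_triangle_left (bakerMap^[n] z) z (bakerMap^[n] w)
  linarith

lemma tail_sum (J h : ℕ) : ∑ j ∈ Finset.range h, (if j < J then (0:ℝ) else (1/2) ^ j) ≤
    2 * (1/2) ^ J := by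
  have : ∑ j ∈ Finset.range h, (if j < J then (0:ℝ) else (1/2) ^ j) ≤
    2 * (1/2) ^ J - 2 * (1/2) ^ (max h J) := by
    induction h with
    | zero => simp
    | succ h ih =>
      rw [Finset.sum_range_succ]
      split_ifs with hh
      · rw [max_eq_right hh.le] at ih
        rw [max_eq_right (show h + 1 ≤ J from hh)]; linarith
      · push Not at hh
        rw [max_eq_left hh] at ih
        rw [max_eq_left (by omega), pow_succ]; linarith
  have h2 : (0:ℝ) < (1/2) ^ (max h J) := by positivity
  linarith

lemma short_sum (z : ℝ × ℝ) (h1 : Irrational z.1) (h2 : Irrational z.2) (hz : z.2 ∈ Ico (0:ℝ) 1)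
    (J : ℕ) : ∀ᶠ ρ in 𝓝[>] (0:ℝ), ∀ h : ℕ,
    ∑ j ∈ Finset.range h, (lam.prod lam).real
      (Metric.ball z ρ ∩ (bakerMap^[j+1])⁻¹' Metric.ball z ρ) ≤
      4 * ρ ^ 2 * (2 * (h * ρ) + 2 * (1/2) ^ J) := by
  have hev : ∀ᶠ ρ in 𝓝[>] (0:ℝ), ∀ j ∈ Finset.range J,
      Metric.ball z ρ ∩ (bakerMap^[j+1])⁻¹' Metric.ball z ρ = ∅ := by
    rw [Filter.eventually_all_finset]
    intro j _
    obtain ⟨ρ₀, hp, hh⟩ := no_return z h1 h2 hz (j+1) (by omega)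
    filter_upwards [Ioc_mem_nhdsGT hp] with ρ hρ
    exact hh ρ hρ.2
  filter_upwards [hev, self_mem_nhdsWithin] with ρ hρ hpos h
  have hpos' : 0 < ρ := hpos
  calc _ ≤ ∑ j ∈ Finset.range h, 4 * ρ ^ 2 * (2 * ρ + (if j < J then (0:ℝ) else (1/2) ^ j)) := by
        refine Finset.sum_le_sum (fun j _ => ?_)
        split_ifs with hj
        · rw [hρ j (Finset.mem_range.2 hj)]; simp; positivity
        · refine (baker_return z ρ hpos (j+1)).trans (le_of_eq ?_)
          congr 2
          rw [pow_succ, one_div, inv_pow]; field_simp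
    _ = 4 * ρ ^ 2 * (2 * (h * ρ) + ∑ j ∈ Finset.range h, (if j < J then (0:ℝ) else (1/2) ^ j)) := by
        rw [← Finset.mul_sum, Finset.sum_add_distrib, Finset.sum_const, Finset.card_range,
          nsmul_eq_mul]; ring
    _ ≤ _ := by
        have := tail_sum J h
        gcongr

lemma per_r (z : ℝ × ℝ) (r t : ℝ) (m k : ℕ) (hr : 0 < r) (ht : 0 < t)
    (hsub : euclBall z r ⊆ unitSq) (hpi : Real.pi * r ^ 2 ≤ 1) (hm : 1 ≤ m)
    (he : 1 / (r * 2 ^ m) ≤ 1 / 2) :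
    |(lam.prod lam).real {x | cnt bakerMap (euclBall z r) (⌊t / (Real.pi * r ^ 2)⌋₊ + 1) x = k} -
      binp (t / (⌊t / (Real.pi * r ^ 2)⌋₊ + 1 : ℕ)) (⌊t / (Real.pi * r ^ 2)⌋₊ + 1) k| ≤
    24 * (t + 1) * (1 / (r * 2 ^ m)) + 2 * (t + 1) / Real.pi *
      ((∑ j ∈ Finset.range (2 * m - 1), (lam.prod lam).real
      (Metric.ball z (2 * r) ∩ (bakerMap^[j+1])⁻¹' Metric.ball z (2 * r))) / r ^ 2) +
      324 * (t + 1) * Real.pi * (m * r) * r + 2 * (Real.pi * r ^ 2) := by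
  have hπ := Real.pi_pos
  have hP : (0:ℝ) < 2 ^ m := by positivity
  set μ := lam.prod lam with hμ
  set B := euclBall z r with hB
  set p : ℝ := Real.pi * r ^ 2 with hp
  have hp0 : 0 < p := by positivity
  set N := ⌊t / p⌋₊ + 1 with hN
  have hN1 : t / p < N := by rw [hN]; push_cast; exact Nat.lt_floor_add_one _
  have hN2 : (N:ℝ) ≤ t / p + 1 := by
    rw [hN]; push_cast; linarith [Nat.floor_le (show 0 ≤ t / p by positivity)]
  have hN0 : (0:ℝ) < N := by rw [hN]; positivity
  have hN3 : N * p ≤ t + 1 := by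
    have : N * p ≤ (t / p + 1) * p := by gcongr
    have e : (t / p + 1) * p = t + p := by field_simp
    linarith
  have hN4 : t < N * p := by rwa [div_lt_iff₀ hp0] at hN1
  have hN5 : N * p ≤ t + p := by
    have : N * p ≤ (t / p + 1) * p := by gcongr
    have e : (t / p + 1) * p = t + p := by field_simp
    linarith
  set q : ℝ := t / (N : ℕ) with hq
  have hq0 : 0 ≤ q := by positivity
  have hNq : N * q = t := by rw [hq]; field_simp
  have hq1 : q ≤ 1 := by
    rw [hq, div_le_one hN0]; nlinarith
  -- measure of ball
  have hμB : μ.real B = p := by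
    rw [hμ, ← restrict_unitSq, Measure.real, Measure.restrict_apply (measurableSet_euclBall z r),
      inter_eq_left.2 hsub, hB, volume_euclBall z r hr.le, ENNReal.toReal_ofReal hp0.le]
  set ε : ℝ := 2 / 2 ^ m with hε
  have hεr : ε ≤ r := by
    rw [hε, div_le_iff₀ hP]
    rw [div_le_iff₀ (by positivity)] at he
    linarith
  have hε0 : 0 < ε := by positivity
  set D := euclBall z (r + ε) \ euclBall z (r - ε) with hD
  have hDm : MeasurableSet D := (measurableSet_euclBall _ _).diff (measurableSet_euclBall _ _)
  set e1 : ℝ := 1 / (r * 2 ^ m) with he1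
  have hμD : μ.real D ≤ 8 * p * e1 := by
    have hss : euclBall z (r - ε) ⊆ euclBall z (r + ε) := by
      intro w hw; rw [mem_euclBall] at *; linarith
    have h1 : volume.real D = Real.pi * (r + ε) ^ 2 - Real.pi * (r - ε) ^ 2 := by
      rw [hD, measureReal_diff hss (measurableSet_euclBall _ _)
        (by rw [volume_euclBall _ _ (by linarith)]; exact ENNReal.ofReal_ne_top),
        Measure.real, Measure.real, volume_euclBall _ _ (by linarith),
        volume_euclBall _ _ (by linarith), ENNReal.toReal_ofReal (by positivity),
        ENNReal.toReal_ofReal (by positivity)]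
    have h2 : μ.real D ≤ volume.real D := by
      rw [hμ, ← restrict_unitSq]
      apply ENNReal.toReal_mono
      · refine ne_top_of_le_ne_top ?_ (measure_mono (diff_subset (s := euclBall z (r + ε))))
        rw [volume_euclBall _ _ (by linarith)]; exact ENNReal.ofReal_ne_top
      · exact Measure.restrict_le_self _
    refine h2.trans (le_of_eq ?_)
    rw [h1, hp, he1, hε]
    field_simp; ring
  have hμD0 : 0 ≤ μ.real D := measureReal_nonneg
  have hNe : N * (p * e1) ≤ (t + 1) * e1 := by
    rw [← mul_assoc]
    exact mul_le_mul_of_nonneg_right hN3 (by positivity)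
  have hND : N * μ.real D ≤ 8 * (t + 1) * e1 := by
    calc N * μ.real D ≤ N * (8 * p * e1) := by gcongr
      _ = 8 * (N * (p * e1)) := by ring
      _ ≤ _ := by linarith
  set A := rnd m ⁻¹' B with hA
  have hAm : MeasurableSet A := measurable_rnd m (measurableSet_euclBall z r)
  have hAB : ∀ x, x ∉ D → (x ∈ A ↔ x ∈ B) := fun x hx => rnd_mem m z x r hx
  have s1 := cnt_approx baker_mp hDm hAB N k
  have hap : |μ.real A - p| ≤ μ.real D := by
    rw [← hμB]
    apply abs_real_sub_le
    · intro x hx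
      by_cases h : x ∈ D
      · exact Or.inr h
      · exact Or.inl ((hAB x h).1 hx)
    · intro x hx
      by_cases h : x ∈ D
      · exact Or.inr h
      · exact Or.inl ((hAB x h).2 hx)
  have ha9 : μ.real A ≤ 9 * p := by
    have := (abs_le.1 hap).2
    have h3 : 8 * p * e1 ≤ 8 * p * 1 := by
      apply mul_le_mul_of_nonneg_left _ (by positivity); linarith
    linarith
  have hAQ : A ⊆ Metric.ball z (2 * r) := by
    intro w hw
    apply euclBall_subset_ball
    rw [mem_euclBall]
    have h1 := dist_rnd m w
    have h2 := dist_triangle (toC w) (toC (rnd m w)) (toC z)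
    rw [hA, mem_preimage, hB, mem_euclBall] at hw
    linarith
  set S := ∑ j ∈ Finset.range (2 * m - 1), μ.real
      (Metric.ball z (2 * r) ∩ (bakerMap^[j+1])⁻¹' Metric.ball z (2 * r)) with hS
  have s2 := poisson_abs (μ := μ) baker_mp hAm (2 * m - 1) (by
    intro n k
    have e : 2 * m - 1 + 1 = m + m := by omega
    rw [e, Measure.real, indep_baker m (measurableSet_euclBall z r) n k, ENNReal.toReal_mul]
    rfl) S (by
    refine Finset.sum_le_sum (fun j _ => measureReal_mono ?_)
    exact inter_subset_inter hAQ (preimage_mono hAQ)) q hq0 hq1 N k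
  have ha0 : 0 ≤ μ.real A := measureReal_nonneg
  have hmc : ((2 * m - 1 : ℕ) : ℝ) ≤ 2 * m := by
    have : 2 * m - 1 ≤ 2 * m := by omega
    exact_mod_cast this
  have g1 : N * (((2 * m - 1 : ℕ) : ℝ) * μ.real A ^ 2) ≤ 162 * (t + 1) * Real.pi * (m * r) * r := by
    calc N * (((2 * m - 1 : ℕ) : ℝ) * μ.real A ^ 2) ≤ N * ((2 * m) * (9 * p) ^ 2) := by gcongr
      _ = 162 * m * p * (N * p) := by ring
      _ ≤ 162 * m * p * (t + 1) := by gcongr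
      _ = _ := by rw [hp]; ring
  have g2 : N * |μ.real A - q| ≤ 8 * (t + 1) * e1 + p := by
    have h1 : |μ.real A - q| ≤ μ.real D + |p - q| := by
      have : μ.real A - q = (μ.real A - p) + (p - q) := by ring
      rw [this]
      exact (abs_add_le _ _).trans (by linarith)
    have h2 : N * |p - q| ≤ p := by
      rw [← abs_of_pos hN0, ← abs_mul, mul_sub, hNq, abs_le]
      constructor <;> linarith
    calc N * |μ.real A - q| ≤ N * (μ.real D + |p - q|) := by gcongr
      _ = N * μ.real D + N * |p - q| := by ring
      _ ≤ _ := by linarith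
  have hS0 : 0 ≤ S := Finset.sum_nonneg (fun _ _ => measureReal_nonneg)
  have g3 : N * S ≤ (t + 1) / Real.pi * (S / r ^ 2) := by
    have : (t + 1) / Real.pi * (S / r ^ 2) = (t + 1) * (S / p) := by rw [hp]; field_simp
    rw [this]
    calc N * S = (N * p) * (S / p) := by field_simp
      _ ≤ _ := by gcongr
  have tri := abs_sub_le (μ.real {x | cnt bakerMap B N x = k}) (μ.real {x | cnt bakerMap A N x = k})
    (binp q N k)
  have e4 : 2 * (t + 1) / Real.pi * (S / r ^ 2) = 2 * ((t + 1) / Real.pi * (S / r ^ 2)) := by ring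
  rw [e4]
  refine tri.trans ((add_le_add s1 s2).trans ?_)
  have e5 : N * (2 * (S + ((2 * m - 1 : ℕ) : ℝ) * μ.real A ^ 2 + |μ.real A - q|)) =
    2 * (N * S) + 2 * (N * (((2 * m - 1 : ℕ) : ℝ) * μ.real A ^ 2)) + 2 * (N * |μ.real A - q|) := by
    ring
  rw [e5]
  linarith

noncomputable def mm (r : ℝ) : ℕ := ⌈1 / √r⌉₊

lemma mm_mul : Tendsto (fun r : ℝ => (mm r : ℝ) * r) (𝓝[>] 0) (𝓝 0) := by
  have h : Tendsto (fun r : ℝ => √r + r) (𝓝[>] 0) (𝓝 0) := by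
    have : ContinuousAt (fun r : ℝ => √r + r) 0 := by fun_prop
    have h2 := this.tendsto
    simp only [Real.sqrt_zero, add_zero] at h2
    exact h2.mono_left nhdsWithin_le_nhds
  refine squeeze_zero' ?_ ?_ h
  · filter_upwards [self_mem_nhdsWithin] with r hr
    have : 0 < r := hr
    positivity
  · filter_upwards [self_mem_nhdsWithin] with r hr
    have hr' : 0 < r := hr
    have h1 : (mm r : ℝ) ≤ 1 / √r + 1 := (Nat.ceil_lt_add_one (by positivity)).le
    have h3 : 1 / √r * r = √r := by
      have := Real.mul_self_sqrt hr'.le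
      have h0 := Real.sqrt_pos.2 hr'
      field_simp
      nlinarith
    calc (mm r : ℝ) * r ≤ (1 / √r + 1) * r := by gcongr
      _ = _ := by rw [add_mul, h3, one_mul]

lemma mm_atTop : Tendsto mm (𝓝[>] 0) atTop := by
  have h1 : Tendsto (fun r : ℝ => √r) (𝓝[>] 0) (𝓝[>] 0) := by
    apply tendsto_nhdsWithin_of_tendsto_nhds_of_eventually_within
    · have := (Real.continuous_sqrt.tendsto 0)
      rw [Real.sqrt_zero] at this
      exact this.mono_left nhdsWithin_le_nhds
    · filter_upwards [self_mem_nhdsWithin] with r hr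
      exact Real.sqrt_pos.2 hr
  have h2 : Tendsto (fun r : ℝ => 1 / √r) (𝓝[>] 0) atTop := by
    simp only [one_div]
    exact tendsto_inv_nhdsGT_zero.comp h1
  exact tendsto_nat_ceil_atTop.comp h2

lemma mm_exp : Tendsto (fun r : ℝ => 1 / (r * 2 ^ (mm r))) (𝓝[>] 0) (𝓝 0) := by
  have h := (tendsto_pow_const_mul_const_pow_of_lt_one 2 (r := (1/2:ℝ)) (by norm_num)
    (by norm_num)).comp mm_atTop
  refine squeeze_zero' ?_ ?_ h
  · filter_upwards [self_mem_nhdsWithin] with r hr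
    have : 0 < r := hr
    positivity
  · filter_upwards [self_mem_nhdsWithin] with r hr
    have hr' : 0 < r := hr
    have h1 : 1 / √r ≤ mm r := Nat.le_ceil _
    have h2 : 1 / r ≤ (mm r : ℝ) ^ 2 := by
      calc 1 / r = (1 / √r) ^ 2 := by rw [div_pow, Real.sq_sqrt hr'.le, one_pow]
        _ ≤ _ := by gcongr
    have h3 : 1 / (r * 2 ^ (mm r)) = 1 / r * (1/2) ^ (mm r) := by
      rw [one_div_pow]; field_simp
    rw [h3]
    exact mul_le_mul_of_nonneg_right h2 (by positivity)

lemma short_tendsto (z : ℝ × ℝ) (h1 : Irrational z.1) (h2 : Irrational z.2)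
    (hz : z.2 ∈ Ico (0:ℝ) 1) : Tendsto (fun r : ℝ =>
      (∑ j ∈ Finset.range (2 * mm r - 1), (lam.prod lam).real
      (Metric.ball z (2 * r) ∩ (bakerMap^[j+1])⁻¹' Metric.ball z (2 * r))) / r ^ 2)
      (𝓝[>] 0) (𝓝 0) := by
  have hpos : ∀ r : ℝ, 0 ≤ (∑ j ∈ Finset.range (2 * mm r - 1), (lam.prod lam).real
      (Metric.ball z (2 * r) ∩ (bakerMap^[j+1])⁻¹' Metric.ball z (2 * r))) / r ^ 2 :=
    fun r => div_nonneg (Finset.sum_nonneg (fun _ _ => measureReal_nonneg)) (sq_nonneg r)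
  rw [Metric.tendsto_nhds]
  intro η hη
  obtain ⟨J, hJ⟩ := exists_pow_lt_of_lt_one (show 0 < η / 64 by positivity)
    (show (1/2 : ℝ) < 1 by norm_num)
  have h2r : Tendsto (fun r : ℝ => 2 * r) (𝓝[>] 0) (𝓝[>] 0) := by
    apply tendsto_nhdsWithin_of_tendsto_nhds_of_eventually_within
    · have : ContinuousAt (fun r : ℝ => 2 * r) 0 := by fun_prop
      have h2 := this.tendsto
      simp only [mul_zero] at h2
      exact h2.mono_left nhdsWithin_le_nhds
    · filter_upwards [self_mem_nhdsWithin] with r hr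
      have : 0 < r := hr
      exact mul_pos two_pos this
  filter_upwards [h2r.eventually (short_sum z h1 h2 hz J), self_mem_nhdsWithin,
    mm_mul.eventually (Iio_mem_nhds (show 0 < η / 256 by positivity))] with r hs hr hm
  have hr' : 0 < r := hr
  have hm' : (mm r : ℝ) * r < η / 256 := hm
  rw [Real.dist_eq, sub_zero, abs_of_nonneg (hpos r), div_lt_iff₀ (by positivity)]
  refine (hs (2 * mm r - 1)).trans_lt ?_
  have hmc : ((2 * mm r - 1 : ℕ) : ℝ) ≤ 2 * mm r := by
    have : 2 * mm r - 1 ≤ 2 * mm r := by omega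
    exact_mod_cast this
  have : ((2 * mm r - 1 : ℕ) : ℝ) * (2 * r) ≤ 2 * mm r * (2 * r) := by gcongr
  calc 4 * (2 * r) ^ 2 * (2 * (((2 * mm r - 1 : ℕ) : ℝ) * (2 * r)) + 2 * (1/2) ^ J)
      ≤ 4 * (2 * r) ^ 2 * (2 * (2 * mm r * (2 * r)) + 2 * (1/2) ^ J) := by gcongr
    _ = r ^ 2 * (128 * (mm r * r) + 32 * (1/2) ^ J) := by ring
    _ < r ^ 2 * η := by
      apply mul_lt_mul_of_pos_left _ (by positivity)
      linarith
    _ = _ := by ring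

lemma binp_tendsto (t : ℝ) (k : ℕ) : Tendsto (fun n : ℕ => binp (t / (n:ℕ)) n k) atTop
    (𝓝 (Real.exp (-t) * t ^ k / (Nat.factorial k))) := by
  refine ProbabilityTheory.tendsto_choose_mul_pow_of_tendsto_mul_atTop (p := fun n : ℕ => t / n) k ?_
  refine tendsto_const_nhds.congr' ?_
  filter_upwards [eventually_ge_atTop 1] with n hn
  have : (n:ℝ) ≠ 0 := by positivity
  field_simp

lemma baker_poisson (z : ℝ × ℝ) (h1 : Irrational z.1) (h2 : Irrational z.2)
    (hz1 : z.1 ∈ Ioo (0:ℝ) 1) (hz2 : z.2 ∈ Ioo (0:ℝ) 1) (t : ℝ) (ht : 0 < t) (k : ℕ) :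
    Tendsto (fun r : ℝ =>
            (volume.restrict unitSq)
              {x : ℝ × ℝ |
                (∑ i ∈ Finset.range
                    (⌊t / ((volume.restrict unitSq) (euclBall z r)).toReal⌋₊ + 1),
                  (euclBall z r).indicator (fun _ => (1:ℕ)) (bakerMap^[i] x)) = k})
          (𝓝[>] 0)
          (𝓝 (ENNReal.ofReal (Real.exp (-t) * t ^ k / (Nat.factorial k)))) := by
  have hπ := Real.pi_pos
  have hsq : Tendsto (fun r : ℝ => Real.pi * r ^ 2) (𝓝[>] 0) (𝓝[>] 0) := by
    apply tendsto_nhdsWithin_of_tendsto_nhds_of_eventually_within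
    · have : ContinuousAt (fun r : ℝ => Real.pi * r ^ 2) 0 := by fun_prop
      have h2 := this.tendsto
      simp only [ne_eq, OfNat.ofNat_ne_zero, not_false_eq_true, zero_pow, mul_zero] at h2
      exact h2.mono_left nhdsWithin_le_nhds
    · filter_upwards [self_mem_nhdsWithin] with r hr
      have : 0 < r := hr
      exact mul_pos hπ (by positivity)
  have hid : Tendsto (fun r : ℝ => r) (𝓝[>] 0) (𝓝 0) := tendsto_id.mono_left nhdsWithin_le_nhds
  have hNt : Tendsto (fun r : ℝ => ⌊t / (Real.pi * r ^ 2)⌋₊ + 1) (𝓝[>] 0) atTop := by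
    refine (tendsto_add_atTop_nat 1).comp ?_
    apply tendsto_nat_floor_atTop.comp
    simp only [div_eq_mul_inv]
    exact (tendsto_inv_nhdsGT_zero.comp hsq).const_mul_atTop ht
  have hsubev : ∀ᶠ r in 𝓝[>] (0:ℝ), euclBall z r ⊆ unitSq := by
    have hn : Ioo (0:ℝ) 1 ×ˢ Ioo (0:ℝ) 1 ∈ 𝓝 z :=
      (isOpen_Ioo.prod isOpen_Ioo).mem_nhds ⟨hz1, hz2⟩
    obtain ⟨ρ, hρ, hsub⟩ := Metric.mem_nhds_iff.1 hn
    filter_upwards [Ioc_mem_nhdsGT hρ] with r hr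
    refine (euclBall_subset_ball z r).trans ((Metric.ball_subset_ball hr.2).trans (hsub.trans ?_))
    exact prod_mono Ioo_subset_Icc_self Ioo_subset_Icc_self
  have hreal : Tendsto (fun r : ℝ => (lam.prod lam).real
      {x | cnt bakerMap (euclBall z r) (⌊t / (Real.pi * r ^ 2)⌋₊ + 1) x = k}) (𝓝[>] 0)
      (𝓝 (Real.exp (-t) * t ^ k / (Nat.factorial k))) := by
    have hb := (binp_tendsto t k).comp hNt
    have hst := short_tendsto z h1 h2 ⟨hz2.1.le, hz2.2⟩
    have herr := ((((mm_exp.const_mul (24 * (t + 1))).add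
      (hst.const_mul (2 * (t + 1) / Real.pi))).add
      ((mm_mul.const_mul (324 * (t + 1) * Real.pi)).mul hid)).add
      ((hsq.mono_right nhdsWithin_le_nhds).const_mul 2))
    simp only [mul_zero, add_zero] at herr
    have hdiff := squeeze_zero_norm' (f := fun r : ℝ => (lam.prod lam).real
      {x | cnt bakerMap (euclBall z r) (⌊t / (Real.pi * r ^ 2)⌋₊ + 1) x = k} -
      binp (t / (⌊t / (Real.pi * r ^ 2)⌋₊ + 1 : ℕ)) (⌊t / (Real.pi * r ^ 2)⌋₊ + 1) k) (by
      filter_upwards [hsubev, self_mem_nhdsWithin, mm_atTop.eventually (eventually_ge_atTop 1),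
        mm_exp.eventually (Iic_mem_nhds (show (0:ℝ) < 1 / 2 by norm_num)),
        hsq.eventually (mem_nhdsWithin_of_mem_nhds (Iic_mem_nhds (show (0:ℝ) < 1 by norm_num)))]
        with r hs hr hm he hp
      rw [Real.norm_eq_abs]
      exact per_r z r t (mm r) k hr ht hs hp hm he) herr
    have := hdiff.add hb
    simpa using this
  refine (ENNReal.tendsto_ofReal hreal).congr' ?_
  filter_upwards [hsubev, self_mem_nhdsWithin] with r hs hr
  have hr' : 0 < r := hr
  rw [Measure.restrict_apply (measurableSet_euclBall z r), inter_eq_left.2 hs,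
    volume_euclBall z r hr'.le, ENNReal.toReal_ofReal (by positivity), restrict_unitSq, Measure.real,
    ENNReal.ofReal_toReal (measure_ne_top _ _)]
  rfl

lemma ae_good : ∀ᵐ z ∂((volume : Measure (ℝ × ℝ)).restrict unitSq),
    Irrational z.1 ∧ Irrational z.2 ∧ z.1 ∈ Ioo (0:ℝ) 1 ∧ z.2 ∈ Ioo (0:ℝ) 1 := by
  have hir : ∀ᵐ x ∂lam, Irrational x := by
    rw [ae_iff]
    have : {a : ℝ | ¬ Irrational a} = range ((↑) : ℚ → ℝ) := by
      ext a; simp [Irrational]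
    rw [this]
    exact measure_mono_null (fun _ h => h)
      (nonpos_iff_eq_zero.1 ((Measure.restrict_le_self _).trans
        (le_of_eq ((countable_range _).measure_zero volume))))
  rw [restrict_unitSq]
  have a1 := Measure.quasiMeasurePreserving_fst (μ := lam) (ν := lam) |>.ae hir
  have a2 := Measure.quasiMeasurePreserving_snd (μ := lam) (ν := lam) |>.ae hir
  have pos : ∀ x : ℝ, Irrational x → x ∈ Ico (0:ℝ) 1 → x ∈ Ioo (0:ℝ) 1 := by
    intro x hx h
    refine ⟨lt_of_le_of_ne h.1 ?_, h.2⟩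
    rintro rfl
    exact hx ⟨0, by simp⟩
  filter_upwards [a1, a2, ae_lam2] with z h1 h2 h3
  exact ⟨h1, h2, pos _ h1 h3.1, pos _ h2 h3.2⟩

end BakerAux

/-- Poisson limit law for the number of visits to shrinking Euclidean balls
around Lebesgue-a.e. center `z` (in particular `z` not periodic) for the
standard baker's map: for every `t > 0` and `k ∈ ℕ`,
`Leb{x ∈ [0,1]² : ∑_{i=0}^{⌊t/Leb B(z,r)⌋} 1_{B(z,r)}(T^i x) = k}`
tends to `e^{-t} t^k / k!` as `r → 0`. -/
theorem stmt_15 :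
    ∀ᵐ z ∂(volume.restrict unitSq),
      (∀ n : ℕ, 1 ≤ n → bakerMap^[n] z ≠ z) ∧
      ∀ t : ℝ, 0 < t → ∀ k : ℕ,
        Tendsto (fun r : ℝ =>
            (volume.restrict unitSq)
              {x : ℝ × ℝ |
                (∑ i ∈ Finset.range
                    (⌊t / ((volume.restrict unitSq) (euclBall z r)).toReal⌋₊ + 1),
                  (euclBall z r).indicator (fun _ => (1:ℕ)) (bakerMap^[i] x)) = k})
          (𝓝[>] 0)
          (𝓝 (ENNReal.ofReal (Real.exp (-t) * t ^ k / (Nat.factorial k)))) := by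
  filter_upwards [ae_good] with z hz
  obtain ⟨h1, h2, h3, h4⟩ := hz
  exact ⟨fun n hn => not_periodic z h1 ⟨h4.1.le, h4.2⟩ n hn,
    fun t ht k => baker_poisson z h1 h2 h3 h4 t ht k⟩
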